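/- arXiv:2604.16096 — 2 statements merged into one kernel-verified Lean document; each statement's English description precedes it below -/
import Mathlib

section
/- Let C ⊆ ℝⁿ be a closed convex cone and let x ∈ ℝⁿ satisfy ⟨x, a⟩ > 0 for every a ∈ C with a ≠ 0. Then the integral ∫_C exp(−⟨x, a⟩) da (with respect to Lebesgue measure) is finite. -/
open MeasureTheory

/-- A continuous linear functional that is positive on the nonzero points of a closed cone `C`
dominates a positive multiple of the norm on `C`. -/
theorem exists_pos_mul_norm_le_of_pos_on_cone {E : Type*} [NormedAddCommGroup E]
    [NormedSpace ℝ E] [FiniteDimensional ℝ E] {C : Set E} (f : E →L[ℝ] ℝ)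
    (hclosed : IsClosed C) (hcone : ∀ a ∈ C, ∀ t : ℝ, 0 < t → t • a ∈ C)
    (hf : ∀ a ∈ C, a ≠ 0 → 0 < f a) :
    ∃ δ : ℝ, 0 < δ ∧ ∀ a ∈ C, δ * ‖a‖ ≤ f a := by
  have : ProperSpace E := FiniteDimensional.proper_real E
  have hK : IsCompact (Metric.sphere (0 : E) 1 ∩ C) :=
    (isCompact_sphere 0 1).inter_right hclosed
  obtain ⟨δ, hδ, hle⟩ := hK.exists_forall_le' f.continuous.continuousOn (a := 0)
    fun a ha => hf a ha.2 (norm_ne_zero_iff.mp (by simp [mem_sphere_zero_iff_norm.mp ha.1]))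
  refine ⟨δ, hδ, fun a ha => ?_⟩
  rcases eq_or_ne a 0 with rfl | hne
  · simp
  have hpos : 0 < ‖a‖ := norm_pos_iff.mpr hne
  have h := hle (‖a‖⁻¹ • a)
    ⟨by simp [norm_smul, hpos.ne'], hcone a ha _ (inv_pos.mpr hpos)⟩
  rw [map_smul, smul_eq_mul, inv_mul_eq_div] at h
  exact (le_div_iff₀ hpos).mp h

/-- On a finite-dimensional space, `exp (-δ * ‖a‖)` is integrable for every `δ > 0`. -/
theorem integrable_exp_neg_mul_norm {E : Type*} [NormedAddCommGroup E] [NormedSpace ℝ E]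
    [FiniteDimensional ℝ E] [MeasurableSpace E] [BorelSpace E] (μ : Measure E)
    [μ.IsAddHaarMeasure] {δ : ℝ} (hδ : 0 < δ) :
    Integrable (fun a : E => Real.exp (-(δ * ‖a‖))) μ := by
  set m := Module.finrank ℝ E + 1 with hm
  have hint : Integrable (fun a : E => (1 + ‖a‖) ^ (-(m : ℝ))) μ :=
    integrable_one_add_norm (by simp [hm])
  refine (hint.const_mul (m.factorial * Real.exp δ / δ ^ m)).mono'
    (by fun_prop) (.of_forall fun a => ?_)
  have ht : 0 < 1 + ‖a‖ := by positivity
  have h := Real.pow_div_factorial_le_exp (δ * (1 + ‖a‖)) (by positivity) m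
  rw [Real.norm_of_nonneg (Real.exp_nonneg _), Real.rpow_neg ht.le, Real.rpow_natCast,
    ← div_eq_mul_inv, div_div, le_div_iff₀ (by positivity), ← mul_pow]
  rw [div_le_iff₀ (by positivity), mul_add, Real.exp_add, mul_one, ← mul_one_add] at h
  calc Real.exp (-(δ * ‖a‖)) * (δ * (1 + ‖a‖)) ^ m
      ≤ Real.exp (-(δ * ‖a‖)) * (Real.exp δ * Real.exp (δ * ‖a‖) * m.factorial) := by gcongr
    _ = m.factorial * Real.exp δ := by
      rw [Real.exp_neg]
      field_simp

/-- Convergence of the Koszul–Vinberg characteristic integral: if `C ⊆ ℝⁿ` is a closed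
convex cone and `⟨x, a⟩ > 0` for every nonzero `a ∈ C`, then `∫_C exp(−⟨x,a⟩) da` is
finite. -/
theorem koszul_vinberg_integrable
    {n : ℕ} (C : Set (Fin n → ℝ)) (x : Fin n → ℝ)
    (hclosed : IsClosed C) (hconv : Convex ℝ C)
    (hcone : ∀ a ∈ C, ∀ t : ℝ, 0 < t → t • a ∈ C)
    (hx : ∀ a ∈ C, a ≠ 0 → 0 < ∑ i, x i * a i) :
    IntegrableOn (fun a : Fin n → ℝ => Real.exp (-(∑ i, x i * a i))) C volume := by
  obtain ⟨δ, hδ, hle⟩ := exists_pos_mul_norm_le_of_pos_on_cone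
    (∑ i, x i • ContinuousLinearMap.proj (R := ℝ) (φ := fun _ : Fin n => ℝ) i)
    hclosed hcone (by simpa using hx)
  refine (integrable_exp_neg_mul_norm volume hδ).integrableOn.mono'
    (Continuous.aestronglyMeasurable (by fun_prop))
    ((ae_restrict_mem hclosed.measurableSet).mono fun a ha => ?_)
  rw [Real.norm_of_nonneg (Real.exp_nonneg _)]
  exact Real.exp_le_exp.mpr (neg_le_neg (by simpa using hle a ha))
end

section
/- Let P ⊆ ℝⁿ be a nonempty open convex cone that is proper (its closure contains no line, i.e. cl P ∩ (−cl P) = {0}), and let a ∈ P. Then the stabilizer subgroup G_a = {g ∈ GL_n(ℝ) : g(P) = P and g a = a} is a compact subset of the space of n×n real matrices. -/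
open Set in
/-- The order interval `{y | a ± y ∈ K}` of a closed pointed cone `K` is bounded. -/
lemma exists_norm_le_of_add_mem_of_sub_mem {E : Type*} [NormedAddCommGroup E] [NormedSpace ℝ E]
    [ProperSpace E] {K : Set E} (hK : IsClosed K) (hcone : ∀ x ∈ K, ∀ t : ℝ, 0 < t → t • x ∈ K)
    (hproper : K ∩ (-K) ⊆ {0}) (a : E) :
    ∃ R : ℝ, ∀ y, a + y ∈ K → a - y ∈ K → ‖y‖ ≤ R := by
  let T : Set (E × ℝ) := (Metric.sphere (0 : E) 1 ×ˢ Icc (0 : ℝ) 1) ∩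
    ({p | p.2 • a + p.1 ∈ K} ∩ {p | p.2 • a - p.1 ∈ K})
  have hT : IsCompact T :=
    ((isCompact_sphere 0 1).prod isCompact_Icc).inter_right
      ((hK.preimage (by fun_prop)).inter (hK.preimage (by fun_prop)))
  have key : ∀ y, a + y ∈ K → a - y ∈ K → 1 < ‖y‖ → (‖y‖⁻¹ • y, ‖y‖⁻¹) ∈ T := by
    intro y h₁ h₂ hy
    have hpos : 0 < ‖y‖⁻¹ := by positivity
    refine ⟨⟨?_, hpos.le, inv_le_one_of_one_le₀ hy.le⟩, ?_, ?_⟩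
    · simp only [mem_sphere_zero_iff_norm, norm_smul, norm_inv, norm_norm]
      exact inv_mul_cancel₀ (by positivity)
    · simpa only [mem_ofPred_eq, ← smul_add] using hcone _ h₁ _ hpos
    · simpa only [mem_ofPred_eq, ← smul_sub] using hcone _ h₂ _ hpos
  rcases T.eq_empty_or_nonempty with hempty | hnonempty
  · refine ⟨1, fun y h₁ h₂ => ?_⟩
    by_contra! hy
    simpa [hempty] using key y h₁ h₂ hy
  · obtain ⟨⟨u, t⟩, hut, hmin⟩ := hT.exists_isMinOn hnonempty continuous_snd.continuousOn
    obtain ⟨⟨hu, ht, -⟩, h₁, h₂⟩ := hut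
    have htpos : 0 < t := by
      refine lt_of_le_of_ne ht fun h => ?_
      subst h
      have hu0 : u = 0 := hproper ⟨by simpa using h₁, by simpa using h₂⟩
      simp [hu0] at hu
    refine ⟨max 1 t⁻¹, fun y h₁ h₂ => ?_⟩
    rcases le_or_gt ‖y‖ 1 with hy | hy
    · exact hy.trans (le_max_left _ _)
    · have hle : t ≤ ‖y‖⁻¹ := hmin (key y h₁ h₂ hy)
      exact ((le_inv_comm₀ htpos (by positivity)).1 hle).trans (le_max_right _ _)

/-- Matrices fixing an interior point `a` of a proper cone and mapping the cone into its closure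
have uniformly bounded entries. -/
lemma exists_abs_entry_le {n : ℕ} {P : Set (Fin n → ℝ)} (hopen : IsOpen P)
    (hcone : ∀ x ∈ P, ∀ t : ℝ, 0 < t → t • x ∈ P)
    (hproper : closure P ∩ (-(closure P)) ⊆ {0}) {a : Fin n → ℝ} (ha : a ∈ P) :
    ∃ C : ℝ, ∀ g : Matrix (Fin n) (Fin n) ℝ, (∀ x ∈ P, g.mulVec x ∈ closure P) →
      g.mulVec a = a → ∀ i j, |g i j| ≤ C := by
  obtain ⟨R, hR⟩ := exists_norm_le_of_add_mem_of_sub_mem isClosed_closure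
    (fun x hx t ht => map_mem_closure (continuous_const_smul t) hx fun y hy => hcone y hy t ht)
    hproper a
  obtain ⟨ε, hε, hball⟩ := Metric.isOpen_iff.1 hopen a ha
  have hε₂ : 0 < ε / 2 := half_pos hε
  refine ⟨R / (ε / 2), fun g hg hga i j => ?_⟩
  let v : Fin n → ℝ := (ε / 2) • Pi.single j 1
  have hv : ‖v‖ < ε := by
    simp only [v, norm_smul, Pi.norm_single, norm_one, mul_one, Real.norm_of_nonneg hε₂.le]
    linarith
  have hadd : a + v ∈ P := hball (by simpa [dist_eq_norm] using hv)
  have hsub : a - v ∈ P := hball (by simpa [dist_eq_norm] using hv)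
  have hbound := hR (g.mulVec v)
    (by simpa only [Matrix.mulVec_add, hga] using hg _ hadd)
    (by simpa only [Matrix.mulVec_sub, hga] using hg _ hsub)
  have hentry := (norm_le_pi_norm _ i).trans hbound
  have hgv : g.mulVec v i = ε / 2 * g i j := by
    simp [v, Matrix.mulVec_smul]
  rw [hgv, norm_mul, Real.norm_of_nonneg hε₂.le, Real.norm_eq_abs] at hentry
  rwa [le_div_iff₀' hε₂]

/-- An invertible matrix mapping an open convex set into its closure preserves the set. -/
lemma mapsTo_mulVec_of_mapsTo_closure {n : ℕ} {P : Set (Fin n → ℝ)} (hopen : IsOpen P)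
    (hconv : Convex ℝ P) {g h : Matrix (Fin n) (Fin n) ℝ} (hgh : g * h = 1) (hhg : h * g = 1)
    (hg : ∀ x ∈ P, g.mulVec x ∈ closure P) : ∀ x ∈ P, g.mulVec x ∈ P := by
  intro x hx
  have hint : interior (closure P) = P := by
    rw [hconv.interior_closure_eq_interior_of_nonempty_interior
      (by rw [hopen.interior_eq]; exact ⟨x, hx⟩), hopen.interior_eq]
  rw [← hint]
  have hpre : IsOpen (h.mulVec ⁻¹' P) := hopen.preimage (by fun_prop)
  refine interior_maximal (fun y hy => ?_) hpre (a := g.mulVec x) ?_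
  · simpa [Matrix.mulVec_mulVec, hgh] using hg _ hy
  · simpa [Matrix.mulVec_mulVec, hhg] using hx

/-- For a proper nonempty open convex cone `P ⊆ ℝⁿ` (its closure contains no line) and
`a ∈ P`, the stabilizer `G_a = {g ∈ G(P) : g a = a}` is a compact subset of the space of
`n×n` real matrices. -/
theorem stabilizer_compact
    {n : ℕ} (P : Set (Fin n → ℝ))
    (hne : P.Nonempty) (hopen : IsOpen P) (hconv : Convex ℝ P)
    (hcone : ∀ x ∈ P, ∀ t : ℝ, 0 < t → t • x ∈ P)
    (hproper : closure P ∩ (-(closure P)) ⊆ {0})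
    (a : Fin n → ℝ) (ha : a ∈ P) :
    IsCompact {g : Matrix (Fin n) (Fin n) ℝ |
        IsUnit g ∧ g.mulVec '' P = P ∧ g.mulVec a = a} := by
  obtain ⟨C, hC⟩ := exists_abs_entry_le hopen hcone hproper ha
  let M := Matrix (Fin n) (Fin n) ℝ
  let B : Set M := Set.univ.pi fun _ => Set.univ.pi fun _ => Set.Icc (-C) C
  have hB : IsCompact B :=
    isCompact_univ_pi fun _ => isCompact_univ_pi fun _ => isCompact_Icc
  let F : Set M := {g | (∀ x ∈ P, g.mulVec x ∈ closure P) ∧ g.mulVec a = a}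
  have hF : IsClosed F := by
    simp only [F, Set.ofPred_and, Set.ofPred_forall]
    exact (isClosed_biInter fun x _ => isClosed_closure.preimage
      (Continuous.matrix_mulVec continuous_id continuous_const)).inter
      (isClosed_eq (Continuous.matrix_mulVec continuous_id continuous_const) continuous_const)
  have hFB : F ⊆ B := fun g hg i _ j _ => abs_le.1 (hC g hg.1 hg.2 i j)
  have hFc : IsCompact F := hB.of_isClosed_subset hF hFB
  let T : Set (M × M) := (F ×ˢ F) ∩ ({p | p.1 * p.2 = 1} ∩ {p | p.2 * p.1 = 1})
  have hT : IsCompact T := (hFc.prod hFc).inter_right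
    ((isClosed_eq (continuous_fst.matrix_mul continuous_snd) continuous_const).inter
      (isClosed_eq (continuous_snd.matrix_mul continuous_fst) continuous_const))
  convert hT.image continuous_fst using 1
  ext g
  constructor
  · rintro ⟨⟨u, rfl⟩, hP, hga⟩
    have hinv : ∀ x, (↑u⁻¹ : M).mulVec ((u : M).mulVec x) = x := fun x => by
      rw [Matrix.mulVec_mulVec, u.inv_mul, Matrix.one_mulVec]
    refine ⟨(u, ↑u⁻¹), ⟨⟨⟨fun x hx => subset_closure ?_, hga⟩, fun x hx => subset_closure ?_, ?_⟩,
      u.mul_inv, u.inv_mul⟩, rfl⟩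
    · exact hP ▸ Set.mem_image_of_mem _ hx
    · rw [← hP] at hx
      obtain ⟨y, hy, rfl⟩ := hx
      rwa [hinv]
    · simpa only [hga] using hinv a
  · rintro ⟨⟨g, h⟩, ⟨⟨hg, hh⟩, hgh, hhg⟩, rfl⟩
    refine ⟨⟨⟨g, h, hgh, hhg⟩, rfl⟩, Set.Subset.antisymm ?_ fun x hx => ⟨h.mulVec x, ?_, ?_⟩, hg.2⟩
    · exact Set.image_subset_iff.2 (mapsTo_mulVec_of_mapsTo_closure hopen hconv hgh hhg hg.1)
    · exact mapsTo_mulVec_of_mapsTo_closure hopen hconv hhg hgh hh.1 x hx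
    · rw [Matrix.mulVec_mulVec, show g * h = 1 from hgh, Matrix.one_mulVec]
end
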